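/- Let V be a finite-dimensional complex vector space with nondegenerate symmetric bilinear form, and consider the superalgebra Λ(V*) ⊗ Λ(V*) with contraction operators i_a = i_a ⊗ 1 + (±)1 ⊗ i_a (tensor product contraction) for a ∈ V. Then the horizontal subspace (Λ(V*) ⊗ Λ(V*))_hor (elements annihilated by all i_a) is the subalgebra generated by the elements δω := ω ⊗ 1 - 1 ⊗ ω for ω ∈ V*, and the projection ω ⊗ η ↦ ε(η)ω (ε the augmentation of Λ(V*)) restricts to a linear isomorphism (Λ(V*) ⊗ Λ(V*))_hor ≅ Λ(V*). -/

import Mathlib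

open scoped TensorProduct
open CliffordAlgebra

namespace HorizontalTensor

section gen
variable {M : Type*} [AddCommGroup M] [Module ℂ M]

local notation "Ext" => ExteriorAlgebra ℂ M
local notation "Q0" => (0 : QuadraticForm ℂ M)

/-- left multiplication by `ω ⊗ 1` -/
noncomputable def L1 (w : M) : Ext ⊗[ℂ] Ext →ₗ[ℂ] Ext ⊗[ℂ] Ext :=
  LinearMap.rTensor _ (LinearMap.mulLeft ℂ (ExteriorAlgebra.ι ℂ w))

/-- left multiplication by `1 ⊗ ω` in the graded tensor product -/
noncomputable def L2 (w : M) : Ext ⊗[ℂ] Ext →ₗ[ℂ] Ext ⊗[ℂ] Ext :=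
  TensorProduct.map (involute (Q := Q0)).toLinearMap
    (LinearMap.mulLeft ℂ (ExteriorAlgebra.ι ℂ w))

/-- the contraction -/
noncomputable def iC (d : Module.Dual ℂ M) : Ext ⊗[ℂ] Ext →ₗ[ℂ] Ext ⊗[ℂ] Ext :=
  LinearMap.rTensor _ (contractLeft (Q := Q0) d)
    + TensorProduct.map (involute (Q := Q0)).toLinearMap (contractLeft (Q := Q0) d)

theorem L1_tmul (w : M) (x y : Ext) :
    L1 w (x ⊗ₜ[ℂ] y) = (ExteriorAlgebra.ι ℂ w * x) ⊗ₜ[ℂ] y := rfl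

theorem L2_tmul (w : M) (x y : Ext) :
    L2 w (x ⊗ₜ[ℂ] y) = (involute (Q := Q0) x) ⊗ₜ[ℂ] (ExteriorAlgebra.ι ℂ w * y) := rfl

theorem iC_tmul (d : Module.Dual ℂ M) (x y : Ext) :
    iC d (x ⊗ₜ[ℂ] y) = (contractLeft (Q := Q0) d x) ⊗ₜ[ℂ] y
      + (involute (Q := Q0) x) ⊗ₜ[ℂ] (contractLeft (Q := Q0) d y) := rfl

theorem contract_ι_mul (d : Module.Dual ℂ M) (w : M) (x : Ext) :
    contractLeft (Q := Q0) d (ExteriorAlgebra.ι ℂ w * x)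
      = d w • x - ExteriorAlgebra.ι ℂ w * contractLeft (Q := Q0) d x :=
  contractLeft_ι_mul d w x

theorem inv_ι_mul (w : M) (x : Ext) :
    involute (Q := Q0) (ExteriorAlgebra.ι ℂ w * x)
      = - (ExteriorAlgebra.ι ℂ w * involute (Q := Q0) x) := by
  have : involute (Q := Q0) (ExteriorAlgebra.ι ℂ w) = - ExteriorAlgebra.ι ℂ w := involute_ι w
  rw [map_mul, this, neg_mul]

theorem inv_inv (x : Ext) : involute (Q := Q0) (involute (Q := Q0) x) = x :=
  involute_involute x

theorem ι_swap (v w : M) (x : Ext) :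
    ExteriorAlgebra.ι ℂ v * (ExteriorAlgebra.ι ℂ w * x)
      = - (ExteriorAlgebra.ι ℂ w * (ExteriorAlgebra.ι ℂ v * x)) := by
  rw [← mul_assoc, ← mul_assoc, eq_neg_of_add_eq_zero_left (ExteriorAlgebra.ι_add_mul_swap v w),
    neg_mul]

theorem contract_inv (d : Module.Dual ℂ M) (x : Ext) :
    contractLeft (Q := Q0) d (involute (Q := Q0) x)
      = - involute (Q := Q0) (contractLeft (Q := Q0) d x) := by
  induction x using CliffordAlgebra.left_induction with
  | algebraMap r => simp
  | add x y hx hy => simp only [map_add, hx, hy, neg_add]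
  | ι_mul x m hx =>
    have h1 := inv_ι_mul m x
    have h2 := contract_ι_mul d m x
    have h3 := contract_ι_mul d m (involute (Q := Q0) x)
    have h4 := inv_ι_mul m (contractLeft (Q := Q0) d x)
    unfold ExteriorAlgebra.ι at h1 h2 h3 h4
    rw [h1, h2, map_neg, h3, hx, map_sub, h4, map_smul, mul_neg]

theorem ext_eq {f g : Ext ⊗[ℂ] Ext →ₗ[ℂ] Ext ⊗[ℂ] Ext}
    (h : ∀ x y : Ext, f (x ⊗ₜ[ℂ] y) = g (x ⊗ₜ[ℂ] y)) (z : Ext ⊗[ℂ] Ext) : f z = g z := by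
  rw [TensorProduct.ext' h]

theorem iC_L1 (d : Module.Dual ℂ M) (w : M) (z : Ext ⊗[ℂ] Ext) :
    iC d (L1 w z) = d w • z - L1 w (iC d z) := by
  refine ext_eq (f := iC d ∘ₗ L1 w) (g := d w • LinearMap.id - L1 w ∘ₗ iC d) (fun x y => ?_) z
  simp only [LinearMap.comp_apply, LinearMap.sub_apply, LinearMap.smul_apply, LinearMap.id_apply,
    L1_tmul, iC_tmul, contract_ι_mul, inv_ι_mul, map_add, TensorProduct.sub_tmul,
    TensorProduct.neg_tmul, TensorProduct.smul_tmul']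
  abel

theorem iC_L2 (d : Module.Dual ℂ M) (w : M) (z : Ext ⊗[ℂ] Ext) :
    iC d (L2 w z) = d w • z - L2 w (iC d z) := by
  refine ext_eq (f := iC d ∘ₗ L2 w) (g := d w • LinearMap.id - L2 w ∘ₗ iC d) (fun x y => ?_) z
  simp only [LinearMap.comp_apply, LinearMap.sub_apply, LinearMap.smul_apply, LinearMap.id_apply,
    L2_tmul, iC_tmul, contract_ι_mul, contract_inv, inv_inv, map_add, TensorProduct.tmul_sub,
    TensorProduct.neg_tmul, TensorProduct.tmul_smul]
  abel

theorem L2_L1 (v w : M) (z : Ext ⊗[ℂ] Ext) : L2 v (L1 w z) = - L1 w (L2 v z) := by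
  refine ext_eq (f := L2 v ∘ₗ L1 w) (g := -(L1 w ∘ₗ L2 v)) (fun x y => ?_) z
  simp only [LinearMap.comp_apply, LinearMap.neg_apply, L1_tmul, L2_tmul, inv_ι_mul,
    TensorProduct.neg_tmul]

theorem L2_L2 (v w : M) (z : Ext ⊗[ℂ] Ext) : L2 v (L2 w z) = - L2 w (L2 v z) := by
  refine ext_eq (f := L2 v ∘ₗ L2 w) (g := -(L2 w ∘ₗ L2 v)) (fun x y => ?_) z
  simp only [LinearMap.comp_apply, LinearMap.neg_apply, L2_tmul, inv_inv, ι_swap v w,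
    TensorProduct.tmul_neg]

theorem L1_L1 (v w : M) (z : Ext ⊗[ℂ] Ext) : L1 v (L1 w z) = - L1 w (L1 v z) := by
  refine ext_eq (f := L1 v ∘ₗ L1 w) (g := -(L1 w ∘ₗ L1 v)) (fun x y => ?_) z
  simp only [LinearMap.comp_apply, LinearMap.neg_apply, L1_tmul, ι_swap v w,
    TensorProduct.neg_tmul]

theorem L1_add (v w : M) : L1 (v + w) = L1 v + L1 w := by
  refine TensorProduct.ext' fun x y => ?_
  simp only [LinearMap.add_apply, L1_tmul, map_add, add_mul, TensorProduct.add_tmul]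

theorem L2_add (v w : M) : L2 (v + w) = L2 v + L2 w := by
  refine TensorProduct.ext' fun x y => ?_
  simp only [LinearMap.add_apply, L2_tmul, map_add, add_mul, TensorProduct.tmul_add]

theorem L1_smul (c : ℂ) (w : M) : L1 (c • w) = c • L1 w := by
  refine TensorProduct.ext' fun x y => ?_
  simp only [LinearMap.smul_apply, L1_tmul, map_smul, smul_mul_assoc, TensorProduct.smul_tmul']

theorem L2_smul (c : ℂ) (w : M) : L2 (c • w) = c • L2 w := by
  refine TensorProduct.ext' fun x y => ?_
  simp only [LinearMap.smul_apply, L2_tmul, map_smul, smul_mul_assoc, TensorProduct.tmul_smul]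

/-- `L2` as a linear map -/
noncomputable def L2lin : M →ₗ[ℂ] Module.End ℂ (Ext ⊗[ℂ] Ext) where
  toFun := L2
  map_add' := L2_add
  map_smul' := L2_smul

/-- left multiplication by `δω`, linearly in `ω` -/
noncomputable def D : M →ₗ[ℂ] Module.End ℂ (Ext ⊗[ℂ] Ext) where
  toFun w := L1 w - L2 w
  map_add' v w := by rw [L1_add, L2_add]; abel
  map_smul' c w := by rw [L1_smul, L2_smul, smul_sub]; rfl

theorem D_apply (w : M) (z : Ext ⊗[ℂ] Ext) : D w z = L1 w z - L2 w z := rfl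

theorem self_neg {N : Type*} [AddCommGroup N] [Module ℂ N] {x : N} (h : x = - x) : x = 0 := by
  have : (2 : ℂ) • x = 0 := by
    rw [two_smul]; nth_rewrite 1 [h]; exact neg_add_cancel x
  exact (smul_eq_zero.mp this).resolve_left two_ne_zero

theorem D_sq (w : M) : D w * D w = 0 := by
  refine LinearMap.ext fun z => ?_
  rw [Module.End.mul_apply, LinearMap.zero_apply]
  simp only [D_apply, map_sub]
  rw [self_neg (L1_L1 w w z), self_neg (L2_L2 w w z), L2_L1]
  abel

theorem iC_D (d : Module.Dual ℂ M) (w : M) (z : Ext ⊗[ℂ] Ext) :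
    iC d (D w z) = - D w (iC d z) := by
  simp only [D_apply, map_sub, iC_L1, iC_L2]; abel

/-- the algebra map `φ` acting by left multiplication -/
noncomputable def phi : Ext →ₐ[ℂ] Module.End ℂ (Ext ⊗[ℂ] Ext) :=
  ExteriorAlgebra.lift ℂ ⟨D, D_sq⟩

theorem phi_ι_mul (w : M) (x : Ext) : phi (ExteriorAlgebra.ι ℂ w * x) = D w * phi x := by
  rw [map_mul, phi, ExteriorAlgebra.lift_ι_apply]

/-! Link with the graded tensor product. -/

local notation "GT" => ((evenOdd (0 : QuadraticForm ℂ M)) ᵍ⊗[ℂ] (evenOdd (0 : QuadraticForm ℂ M)))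
local notation "oF" => (GradedTensorProduct.of ℂ (evenOdd (0 : QuadraticForm ℂ M)) (evenOdd (0 : QuadraticForm ℂ M)))

theorem of_L1 (w : M) (z : Ext ⊗[ℂ] Ext) :
    oF (ExteriorAlgebra.ι ℂ w ⊗ₜ[ℂ] 1) * oF z = oF (L1 w z) := by
  induction z using TensorProduct.induction_on with
  | zero => simp only [map_zero, mul_zero]
  | add x y hx hy => simp only [map_add, mul_add, hx, hy]
  | tmul x y =>
    rw [L1_tmul]
    induction x using DirectSum.Decomposition.inductionOn (evenOdd Q0) with
    | zero => simp only [mul_zero, TensorProduct.zero_tmul, map_zero]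
    | add x x' hx hx' => simp only [mul_add, TensorProduct.add_tmul, map_add, hx, hx']
    | homogeneous x =>
      exact GradedTensorProduct.tmul_one_mul_coe_tmul (evenOdd Q0) (evenOdd Q0) _ x y

theorem of_L2 (w : M) (z : Ext ⊗[ℂ] Ext) :
    oF (1 ⊗ₜ[ℂ] ExteriorAlgebra.ι ℂ w) * oF z = oF (L2 w z) := by
  induction z using TensorProduct.induction_on with
  | zero => simp only [map_zero, mul_zero]
  | add x y hx hy => simp only [map_add, mul_add, hx, hy]
  | tmul x y =>
    rw [L2_tmul]
    induction x using DirectSum.Decomposition.inductionOn (evenOdd Q0) with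
    | zero => simp only [mul_zero, TensorProduct.zero_tmul, map_zero]
    | add x x' hx hx' => simp only [mul_add, TensorProduct.add_tmul, map_add, hx, hx']
    | @homogeneous i x =>
      have h := GradedTensorProduct.tmul_coe_mul_coe_tmul (R := ℂ) (evenOdd Q0) (evenOdd Q0) 1
        (⟨ExteriorAlgebra.ι ℂ w, ι_mem_evenOdd_one Q0 w⟩ : evenOdd Q0 1) x y
      refine h.trans ?_
      obtain ⟨x, hx⟩ := x
      rw [one_mul, one_mul]
      have hi : i = 0 ∨ i = 1 := (by decide : ∀ i : ZMod 2, i = 0 ∨ i = 1) i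
      rcases hi with rfl | rfl
      · rw [uzpow_zero, one_smul]
        have := involute_eq_of_mem_even hx
        rw [this]
      · rw [uzpow_one]
        have := involute_eq_of_mem_odd hx
        rw [this, TensorProduct.neg_tmul, map_neg, Units.neg_smul, one_smul]

theorem of_D (w : M) (z : Ext ⊗[ℂ] Ext) :
    oF (ExteriorAlgebra.ι ℂ w ⊗ₜ[ℂ] 1 - 1 ⊗ₜ[ℂ] ExteriorAlgebra.ι ℂ w) * oF z = oF (D w z) := by
  rw [map_sub, sub_mul, of_L1, of_L2, D_apply, map_sub]

/-- the subalgebra generated by the `δω` -/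
noncomputable def S (M : Type*) [AddCommGroup M] [Module ℂ M] :
    Subalgebra ℂ ((evenOdd (0 : QuadraticForm ℂ M)) ᵍ⊗[ℂ] (evenOdd (0 : QuadraticForm ℂ M))) :=
  Algebra.adjoin ℂ (Set.range fun w : M => GradedTensorProduct.of ℂ _ _
    ((ExteriorAlgebra.ι ℂ w) ⊗ₜ[ℂ] 1 - 1 ⊗ₜ[ℂ] (ExteriorAlgebra.ι ℂ w)))

theorem S_induct (P : Submodule ℂ (Ext ⊗[ℂ] Ext)) (h1 : (1 ⊗ₜ[ℂ] 1) ∈ P)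
    (hD : ∀ w, ∀ z ∈ P, D w z ∈ P) (s : GT) (hs : s ∈ S M) : (oF).symm s ∈ P := by
  suffices h : ∀ z ∈ P, (oF).symm (s * oF z) ∈ P by
    have := h _ h1
    have e : oF ((1 : Ext) ⊗ₜ[ℂ] (1 : Ext)) = 1 := rfl
    rwa [e, mul_one] at this
  induction hs using Algebra.adjoin_induction with
  | mem x hx =>
    obtain ⟨w, rfl⟩ := hx
    intro z hz
    have := of_D w z
    simp only at this ⊢
    rw [this]
    exact hD w z hz
  | algebraMap r =>
    intro z hz
    rw [← Algebra.smul_def, map_smul]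
    exact P.smul_mem r hz
  | add x y _ _ hx hy =>
    intro z hz
    rw [add_mul, map_add]
    exact P.add_mem (hx z hz) (hy z hz)
  | mul x y _ _ hx hy =>
    intro z hz
    rw [mul_assoc]
    exact hx _ (hy z hz)

theorem one_mem_S : oF ((1 : Ext) ⊗ₜ[ℂ] (1 : Ext)) ∈ S M := (S M).one_mem

theorem D_mem_S (w : M) (z : Ext ⊗[ℂ] Ext) (hz : oF z ∈ S M) : oF (D w z) ∈ S M := by
  rw [← of_D]
  exact (S M).mul_mem (Algebra.subset_adjoin ⟨w, rfl⟩) hz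

theorem phi_mem_S (y : Ext) : oF (phi y (1 ⊗ₜ[ℂ] 1)) ∈ S M := by
  induction y using CliffordAlgebra.left_induction with
  | algebraMap r =>
    have : phi (algebraMap ℂ Ext r) ((1 : Ext) ⊗ₜ[ℂ] (1 : Ext)) = r • ((1 : Ext) ⊗ₜ[ℂ] (1 : Ext)) := by
      rw [AlgHom.commutes]; rfl
    rw [this, map_smul]
    exact (S M).smul_mem one_mem_S r
  | add x y hx hy =>
    rw [map_add, LinearMap.add_apply, map_add]
    exact (S M).add_mem hx hy
  | ι_mul x m hx =>
    have := phi_ι_mul m x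
    unfold ExteriorAlgebra.ι at this
    rw [this]
    exact D_mem_S m _ hx

theorem S_le_phi (s : GT) (hs : s ∈ S M) : ∃ y : Ext, (oF).symm s = phi y (1 ⊗ₜ[ℂ] 1) := by
  have := S_induct (LinearMap.range
    ((LinearMap.applyₗ ((1 : Ext) ⊗ₜ[ℂ] (1 : Ext)) :
      Module.End ℂ (Ext ⊗[ℂ] Ext) →ₗ[ℂ] (Ext ⊗[ℂ] Ext)) ∘ₗ (phi (M := M)).toLinearMap))
    ⟨1, by simp⟩ (by
      rintro w _ ⟨y, rfl⟩
      refine ⟨ExteriorAlgebra.ι ℂ w * y, ?_⟩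
      simp [phi_ι_mul]) s hs
  obtain ⟨y, hy⟩ := this
  exact ⟨y, hy.symm⟩

theorem iC_one (d : Module.Dual ℂ M) : iC d ((1 : Ext) ⊗ₜ[ℂ] (1 : Ext)) = 0 := by
  rw [iC_tmul]
  have : contractLeft (Q := Q0) d 1 = 0 := contractLeft_one Q0 d
  rw [this]; simp

theorem iC_S (d : Module.Dual ℂ M) (s : GT) (hs : s ∈ S M) : iC d ((oF).symm s) = 0 := by
  refine S_induct (LinearMap.ker (iC d)) (iC_one d) (fun w z hz => ?_) s hs
  rw [LinearMap.mem_ker] at hz ⊢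
  rw [iC_D, hz, map_zero, neg_zero]

theorem pi_phi (p : Ext ⊗[ℂ] Ext →ₗ[ℂ] Ext)
    (hp : ∀ x y : Ext, p (x ⊗ₜ[ℂ] y) = ExteriorAlgebra.algebraMapInv y • x) (y : Ext)  :
    p (phi y (1 ⊗ₜ[ℂ] 1)) = y := by
  have hD : ∀ (w : M) z, p (D w z) = ExteriorAlgebra.ι ℂ w * p z := by
    intro w z
    induction z using TensorProduct.induction_on with
    | zero => simp only [map_zero, mul_zero]
    | add x y hx hy => simp only [map_add, mul_add, hx, hy]
    | tmul x y =>
      have : ExteriorAlgebra.algebraMapInv (ExteriorAlgebra.ι ℂ w) = 0 := by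
        simp [ExteriorAlgebra.algebraMapInv]
      rw [D_apply, L1_tmul, L2_tmul, map_sub, hp, hp, hp, map_mul, this, zero_mul, zero_smul,
        sub_zero, mul_smul_comm]
  induction y using CliffordAlgebra.left_induction with
  | algebraMap r =>
    have : phi (algebraMap ℂ Ext r) ((1 : Ext) ⊗ₜ[ℂ] (1 : Ext)) = r • ((1 : Ext) ⊗ₜ[ℂ] (1 : Ext)) := by
      rw [AlgHom.commutes]; rfl
    rw [this, map_smul, hp, map_one, one_smul, Algebra.algebraMap_eq_smul_one]
  | add x y hx hy =>
    rw [map_add, LinearMap.add_apply, map_add, hx, hy]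
  | ι_mul x m hx =>
    have := phi_ι_mul m x
    have h2 := hD m (phi x (1 ⊗ₜ[ℂ] 1))
    unfold ExteriorAlgebra.ι at this h2
    rw [this, Module.End.mul_apply, h2, hx]

/-- everything is generated from `1 ⊗ 1` by `D` and `L2` -/
theorem gen_top (W : Submodule ℂ (Ext ⊗[ℂ] Ext)) (h1 : (1 ⊗ₜ[ℂ] 1) ∈ W)
    (hD : ∀ w, ∀ z ∈ W, D w z ∈ W) (hL : ∀ w, ∀ z ∈ W, L2 w z ∈ W) (z : Ext ⊗[ℂ] Ext) :
    z ∈ W := by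
  have hL1 : ∀ w, ∀ z ∈ W, L1 w z ∈ W := by
    intro w z hz
    have := W.add_mem (hD w z hz) (hL w z hz)
    rwa [D_apply, sub_add_cancel] at this
  have hone : ∀ y : Ext, (1 ⊗ₜ[ℂ] y) ∈ W := by
    intro y
    induction y using CliffordAlgebra.left_induction with
    | algebraMap r =>
      rw [Algebra.algebraMap_eq_smul_one, TensorProduct.tmul_smul]
      exact W.smul_mem r h1
    | add x y hx hy => rw [TensorProduct.tmul_add]; exact W.add_mem hx hy
    | ι_mul x m hx =>
      have := hL m _ hx
      rwa [L2_tmul, map_one] at this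
  induction z using TensorProduct.induction_on with
  | zero => exact W.zero_mem
  | add x y hx hy => exact W.add_mem hx hy
  | tmul x y =>
    induction x using CliffordAlgebra.left_induction with
    | algebraMap r =>
      rw [Algebra.algebraMap_eq_smul_one, ← TensorProduct.smul_tmul']
      exact W.smul_mem r (hone y)
    | add x y hx hy => rw [TensorProduct.add_tmul]; exact W.add_mem hx hy
    | ι_mul x m hx => exact hL1 m _ hx

end gen

section dual
variable {V : Type*} [AddCommGroup V] [Module ℂ V] [FiniteDimensional ℂ V]

local notation "M" => Module.Dual ℂ V
local notation "Ext" => ExteriorAlgebra ℂ (Module.Dual ℂ V)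

/-- the Euler-type operator -/
noncomputable def K (V : Type*) [AddCommGroup V] [Module ℂ V] [FiniteDimensional ℂ V] :
    Module.End ℂ (ExteriorAlgebra ℂ (Module.Dual ℂ V) ⊗[ℂ] ExteriorAlgebra ℂ (Module.Dual ℂ V)) :=
  ∑ j, L2 ((Module.finBasis ℂ V).coord j) ∘ₗ
    iC (Module.Dual.eval ℂ V (Module.finBasis ℂ V j))

theorem K_apply (z : Ext ⊗[ℂ] Ext) : K V z = ∑ j, L2 ((Module.finBasis ℂ V).coord j)
    (iC (Module.Dual.eval ℂ V (Module.finBasis ℂ V j)) z) := by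
  simp [K, LinearMap.sum_apply]

theorem sum_L2 (w : M) (z : Ext ⊗[ℂ] Ext) :
    ∑ j, w (Module.finBasis ℂ V j) • L2 ((Module.finBasis ℂ V).coord j) z = L2 w z := by
  have h : L2lin w z = L2 w z := rfl
  rw [← h]
  conv_rhs => rw [← (Module.finBasis ℂ V).sum_dual_apply_smul_coord w]
  simp only [map_sum, map_smul, LinearMap.sum_apply, LinearMap.smul_apply]
  rfl

theorem K_L1 (w : M) (z : Ext ⊗[ℂ] Ext) : K V (L1 w z) = L2 w z + L1 w (K V z) := by
  rw [K_apply, K_apply, ← sum_L2 w z, map_sum, ← Finset.sum_add_distrib]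
  refine Finset.sum_congr rfl fun j _ => ?_
  rw [iC_L1, map_sub, map_smul, L2_L1, sub_neg_eq_add]
  rfl

theorem K_L2 (w : M) (z : Ext ⊗[ℂ] Ext) : K V (L2 w z) = L2 w z + L2 w (K V z) := by
  conv_rhs => rw [← sum_L2 w z]
  rw [K_apply, K_apply, map_sum, ← Finset.sum_add_distrib]
  refine Finset.sum_congr rfl fun j _ => ?_
  rw [iC_L2, map_sub, map_smul, L2_L2 _ w, sub_neg_eq_add]
  rfl

theorem K_D (w : M) (z : Ext ⊗[ℂ] Ext) : K V (D w z) = D w (K V z) := by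
  rw [D_apply, D_apply, map_sub, K_L1, K_L2]; abel

theorem mem_S_of_K (z : Ext ⊗[ℂ] Ext) (hz : K V z = 0) :
    GradedTensorProduct.of ℂ (evenOdd (0 : QuadraticForm ℂ M)) (evenOdd (0 : QuadraticForm ℂ M)) z
      ∈ S M := by
  set T : Submodule ℂ (Ext ⊗[ℂ] Ext) := (Subalgebra.toSubmodule (S M)).comap
    (GradedTensorProduct.of ℂ (evenOdd (0 : QuadraticForm ℂ M))
      (evenOdd (0 : QuadraticForm ℂ M))).toLinearMap with hT
  have hTK : ∀ s ∈ T, K V s = 0 := by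
    intro s hs
    rw [K_apply]
    refine Finset.sum_eq_zero fun j _ => ?_
    have : iC (Module.Dual.eval ℂ V (Module.finBasis ℂ V j)) s = 0 := iC_S _ _ hs
    rw [this, map_zero]
  set G : Submodule ℂ (Ext ⊗[ℂ] Ext) := ⨆ k : ℕ, (K V).eigenspace ((k : ℂ) + 1) with hG
  have hk : ∀ k : ℕ, (K V).eigenspace ((k : ℂ) + 1) ≤ G := fun k =>
    le_iSup (fun k : ℕ => (K V).eigenspace ((k : ℂ) + 1)) k
  have hGD : ∀ w, ∀ g ∈ G, D w g ∈ G := by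
    intro w
    change G ≤ G.comap (D w)
    refine iSup_le fun k x hx => hk k ?_
    rw [Module.End.mem_eigenspace_iff] at hx ⊢
    rw [K_D, hx, map_smul]
  have hGL : ∀ w, ∀ g ∈ G, L2 w g ∈ G := by
    intro w
    change G ≤ G.comap (L2 w)
    refine iSup_le fun k x hx => hk (k + 1) ?_
    rw [Module.End.mem_eigenspace_iff] at hx ⊢
    rw [K_L2, hx, map_smul]
    push_cast
    module
  have hTL : ∀ w, ∀ t ∈ T, L2 w t ∈ G := by
    intro w t ht
    refine hk 0 ?_
    rw [Module.End.mem_eigenspace_iff, K_L2, hTK t ht, map_zero]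
    simp
  have htop : z ∈ T ⊔ G := by
    refine gen_top (T ⊔ G) (Submodule.mem_sup_left one_mem_S) ?_ ?_ z
    · intro w x hx
      obtain ⟨t, ht, g, hg, rfl⟩ := Submodule.mem_sup.mp hx
      rw [map_add]
      exact Submodule.add_mem_sup (D_mem_S w t ht) (hGD w g hg)
    · intro w x hx
      obtain ⟨t, ht, g, hg, rfl⟩ := Submodule.mem_sup.mp hx
      rw [map_add]
      exact Submodule.mem_sup_right (G.add_mem (hTL w t ht) (hGL w g hg))
  obtain ⟨t, ht, g, hg, rfl⟩ := Submodule.mem_sup.mp htop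
  have hg0 : g ∈ (K V).eigenspace 0 := by
    rw [Module.End.mem_eigenspace_iff, zero_smul]
    rwa [map_add, hTK t ht, zero_add] at hz
  have hle : G ≤ ⨆ (j : ℂ) (_ : j ≠ 0), (K V).eigenspace j := by
    refine iSup_le fun k => ?_
    exact le_iSup₂_of_le ((k : ℂ) + 1) (by exact_mod_cast Nat.succ_ne_zero k) le_rfl
  have hdis := (K V).eigenspaces_iSupIndep 0
  have : g = 0 := by
    have := (Submodule.disjoint_def.mp hdis) g hg0 (hle hg)
    exact this
  rw [this, add_zero]
  exact ht

end dual

end HorizontalTensor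

/-- Let `V` be a finite-dimensional complex vector space (with a
nondegenerate symmetric bilinear form), and consider the super tensor product
`Λ(V*) ⊗ Λ(V*)` (graded tensor product of the exterior algebra of the dual with
itself), with the tensor-product contraction operators
`i_a(ω ⊗ η) = (i_a ω) ⊗ η + (-1)^{|ω|} ω ⊗ (i_a η)` for `a ∈ V`.  Then the horizontal
subspace (elements killed by every `i_a`) is the subalgebra generated by the elements
`δω = ω ⊗ 1 - 1 ⊗ ω`, `ω ∈ V*`, and the projection `ω ⊗ η ↦ ε(η)ω` (with `ε` the
augmentation) restricts to a linear isomorphism of the horizontal subspace with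
`Λ(V*)`. -/
theorem horizontal_subspace_of_tensor_square_exterior
    {V : Type*} [AddCommGroup V] [Module ℂ V] [FiniteDimensional ℂ V]
    (B : LinearMap.BilinForm ℂ V)
    (hsymm : ∀ v w : V, B v w = B w v)
    (hnondeg : B.Nondegenerate)
    -- the contraction operators `i_a` on `Λ(V*) ⊗ Λ(V*)` (with Koszul sign)
    (iOp : V → (ExteriorAlgebra ℂ (Module.Dual ℂ V) ⊗[ℂ] ExteriorAlgebra ℂ (Module.Dual ℂ V)
      →ₗ[ℂ] ExteriorAlgebra ℂ (Module.Dual ℂ V) ⊗[ℂ] ExteriorAlgebra ℂ (Module.Dual ℂ V)))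
    (hiOp : ∀ a : V, iOp a =
      LinearMap.rTensor _
        (contractLeft (Q := (0 : QuadraticForm ℂ (Module.Dual ℂ V)))
          (Module.Dual.eval ℂ V a))
      + TensorProduct.map
          (involute (Q := (0 : QuadraticForm ℂ (Module.Dual ℂ V)))).toLinearMap
          (contractLeft (Q := (0 : QuadraticForm ℂ (Module.Dual ℂ V)))
            (Module.Dual.eval ℂ V a)))
    -- the projection `ω ⊗ η ↦ ε(η)·ω`
    (π : ExteriorAlgebra ℂ (Module.Dual ℂ V) ⊗[ℂ] ExteriorAlgebra ℂ (Module.Dual ℂ V)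
      →ₗ[ℂ] ExteriorAlgebra ℂ (Module.Dual ℂ V))
    (hπ : ∀ ω η : ExteriorAlgebra ℂ (Module.Dual ℂ V),
      π (ω ⊗ₜ[ℂ] η) = ExteriorAlgebra.algebraMapInv η • ω) :
    -- (1) horizontal = super-subalgebra generated by the `δω`
    (∀ x : (evenOdd (0 : QuadraticForm ℂ (Module.Dual ℂ V))) ᵍ⊗[ℂ]
        (evenOdd (0 : QuadraticForm ℂ (Module.Dual ℂ V))),
      (∀ a : V, iOp a ((GradedTensorProduct.of ℂ _ _).symm x) = 0) ↔
        x ∈ Algebra.adjoin ℂ (Set.range fun ω : Module.Dual ℂ V =>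
          GradedTensorProduct.of ℂ _ _
            ((ExteriorAlgebra.ι ℂ ω) ⊗ₜ[ℂ] 1 - 1 ⊗ₜ[ℂ] (ExteriorAlgebra.ι ℂ ω)))) ∧
    -- (2) the projection restricts to a linear isomorphism from the horizontal subspace
    Function.Bijective
      (fun x : (⨅ a : V, LinearMap.ker (iOp a) :
          Submodule ℂ (ExteriorAlgebra ℂ (Module.Dual ℂ V) ⊗[ℂ]
            ExteriorAlgebra ℂ (Module.Dual ℂ V))) =>
        π (x : ExteriorAlgebra ℂ (Module.Dual ℂ V) ⊗[ℂ]
          ExteriorAlgebra ℂ (Module.Dual ℂ V))) := by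
  have hi : ∀ a, iOp a = HorizontalTensor.iC (Module.Dual.eval ℂ V a) := hiOp
  have key : ∀ x : (evenOdd (0 : QuadraticForm ℂ (Module.Dual ℂ V))) ᵍ⊗[ℂ]
        (evenOdd (0 : QuadraticForm ℂ (Module.Dual ℂ V))),
      (∀ a : V, iOp a ((GradedTensorProduct.of ℂ _ _).symm x) = 0) ↔
        x ∈ HorizontalTensor.S (Module.Dual ℂ V) := by
    intro x
    constructor
    · intro h
      refine HorizontalTensor.mem_S_of_K ((GradedTensorProduct.of ℂ _ _).symm x) ?_
      rw [HorizontalTensor.K_apply]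
      refine Finset.sum_eq_zero fun j _ => ?_
      rw [← hi, h, map_zero]
    · intro h a
      rw [hi]
      exact HorizontalTensor.iC_S _ x h
  refine ⟨key, ?_, ?_⟩
  · have aux : ∀ x : (⨅ a : V, LinearMap.ker (iOp a) :
          Submodule ℂ (ExteriorAlgebra ℂ (Module.Dual ℂ V) ⊗[ℂ]
            ExteriorAlgebra ℂ (Module.Dual ℂ V))),
        (x : ExteriorAlgebra ℂ (Module.Dual ℂ V) ⊗[ℂ] ExteriorAlgebra ℂ (Module.Dual ℂ V))
          = HorizontalTensor.phi (π x) (1 ⊗ₜ[ℂ] 1) := by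
      rintro ⟨x, hx⟩
      have hS := (key (GradedTensorProduct.of ℂ _ _ x)).mp
        (fun a => (Submodule.mem_iInf _).mp hx a)
      obtain ⟨y, hy⟩ := HorizontalTensor.S_le_phi _ hS
      have hy' : x = HorizontalTensor.phi y (1 ⊗ₜ[ℂ] 1) := hy
      change x = HorizontalTensor.phi (π x) (1 ⊗ₜ[ℂ] 1)
      have : π x = y := by rw [hy']; exact HorizontalTensor.pi_phi π hπ y
      rw [this]
      exact hy'
    intro x y hxy
    apply Subtype.ext
    rw [aux x, aux y]
    exact congrArg (fun t => HorizontalTensor.phi t (1 ⊗ₜ[ℂ] 1)) hxy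
  · intro y
    refine ⟨⟨HorizontalTensor.phi y (1 ⊗ₜ[ℂ] 1), ?_⟩, HorizontalTensor.pi_phi π hπ y⟩
    rw [Submodule.mem_iInf]
    intro a
    exact (key _).mpr (HorizontalTensor.phi_mem_S y) a
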